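/- arXiv:1701.00360 — 2 statements merged into one kernel-verified Lean document; each statement's English description precedes it below -/
import Mathlib

section
/- Let Z be standard normal, h: ℝ → ℝ bounded and measurable, and let f_h(w) = −e^{w²/2} ∫_w^∞ e^{−t²/2}(h(t) − E h(Z)) dt. Then sup_w |f_h(w)| ≤ √(π/2)·sup_w |h(w) − E h(Z)|, and at every point w where f_h is differentiable, |f_h'(w)| ≤ 2·sup_w |h(w) − E h(Z)|. -/
open MeasureTheory ProbabilityTheory Real

lemma integrable_exp_neg_sq_div_two : Integrable (fun t : ℝ => exp (-(t ^ 2) / 2)) := by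
  convert! integrable_exp_neg_mul_sq (b := 1 / 2) (by norm_num) using 3
  ring

lemma integrable_exp_neg_sq_div_two_mul {k : ℝ → ℝ} {C : ℝ} (hk : Measurable k)
    (hC : ∀ t, |k t| ≤ C) : Integrable (fun t : ℝ => exp (-(t ^ 2) / 2) * k t) :=
  integrable_exp_neg_sq_div_two.mul_bdd hk.aestronglyMeasurable (ae_of_all _ hC)

lemma integral_Ioi_zero_exp_neg_sq_div_two :
    ∫ t in Set.Ioi (0 : ℝ), exp (-(t ^ 2) / 2) = √(π / 2) := by
  have h := integral_gaussian_Ioi (1 / 2)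
  have h4 : √(π / (1 / 2)) / 2 = √(π / 2) := by
    rw [show π / (1 / 2) = 2 ^ 2 * (π / 2) by ring, sqrt_mul (by positivity),
      sqrt_sq (by norm_num)]
    ring
  rw [← h4, ← h]
  congr 1 with t
  congr 1
  ring

lemma integral_Ioi_exp_neg_sq_div_two_le {w : ℝ} (hw : 0 ≤ w) :
    ∫ t in Set.Ioi w, exp (-(t ^ 2) / 2) ≤ exp (-(w ^ 2) / 2) * √(π / 2) := by
  have h := (measurePreserving_add_right volume w).setIntegral_preimage_emb
    (measurableEmbedding_addRight w) (fun t : ℝ => exp (-(t ^ 2) / 2)) (Set.Ioi w)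
  have hset : (fun x => x + w) ⁻¹' Set.Ioi w = Set.Ioi 0 := by
    ext x
    simp
  rw [hset] at h
  rw [← h, ← integral_Ioi_zero_exp_neg_sq_div_two, ← integral_const_mul]
  refine setIntegral_mono_on (integrable_exp_neg_sq_div_two.comp_add_right w).integrableOn
    (integrable_exp_neg_sq_div_two.const_mul _).integrableOn measurableSet_Ioi fun s hs => ?_
  rw [← exp_add, exp_le_exp]
  nlinarith [mul_nonneg hw (le_of_lt (Set.mem_Ioi.mp hs))]

lemma mul_integral_Ioi_exp_neg_sq_div_two_le (w : ℝ) :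
    w * ∫ t in Set.Ioi w, exp (-(t ^ 2) / 2) ≤ exp (-(w ^ 2) / 2) := by
  have hint : Integrable (fun t : ℝ => t * exp (-(t ^ 2) / 2)) := by
    convert! integrable_mul_exp_neg_mul_sq (b := 1 / 2) (by norm_num) using 4
    ring
  have hder : ∀ x ∈ Set.Ici w, HasDerivAt (fun t : ℝ => -exp (-(t ^ 2) / 2))
      (x * exp (-(x ^ 2) / 2)) x := fun x _ => by
    have h := ((((hasDerivAt_id x).pow 2).neg.div_const 2).exp).neg
    convert! h using 1
    simp
    ring
  have hlim : Filter.Tendsto (fun t : ℝ => -exp (-(t ^ 2) / 2)) Filter.atTop (nhds 0) := by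
    rw [← neg_zero]
    refine (tendsto_exp_atBot.comp ?_).neg
    have := Filter.tendsto_neg_atTop_atBot.comp
      ((Filter.tendsto_pow_atTop (α := ℝ) two_ne_zero).atTop_div_const (r := 2) (by norm_num))
    refine this.congr fun x => ?_
    simp [neg_div]
  have key := integral_Ioi_of_hasDerivAt_of_tendsto' hder hint.integrableOn hlim
  rw [zero_sub, neg_neg] at key
  rw [← key, ← integral_const_mul]
  refine setIntegral_mono_on (integrable_exp_neg_sq_div_two.const_mul _).integrableOn
    hint.integrableOn measurableSet_Ioi fun s hs => ?_
  exact mul_le_mul_of_nonneg_right (le_of_lt hs) (exp_pos _).le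

lemma hasDerivAt_integral_Ioi_exp_neg_sq_div_two (w : ℝ) :
    HasDerivAt (fun y : ℝ => ∫ t in Set.Ioi y, exp (-(t ^ 2) / 2)) (-exp (-(w ^ 2) / 2)) w := by
  have hcont : Continuous (fun t : ℝ => exp (-(t ^ 2) / 2)) := by fun_prop
  have h := (hcont.integral_hasStrictDerivAt 0 w).hasDerivAt.const_sub
    (∫ t in Set.Ioi (0 : ℝ), exp (-(t ^ 2) / 2))
  refine h.congr_of_eventuallyEq (.of_forall fun y => ?_)
  have := intervalIntegral.integral_interval_add_Ioi (a := 0) (b := y)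
    integrable_exp_neg_sq_div_two.integrableOn integrable_exp_neg_sq_div_two.integrableOn
  simp only
  linarith

lemma le_of_hasDerivAt_integral_Ioi_exp_neg_sq_div_two_mul {k : ℝ → ℝ} {C d w : ℝ}
    (hk : Measurable k) (hC : ∀ t, |k t| ≤ C)
    (hd : HasDerivAt (fun y : ℝ => ∫ t in Set.Ioi y, exp (-(t ^ 2) / 2) * k t) d w) :
    d ≤ C * exp (-(w ^ 2) / 2) := by
  have hki := integrable_exp_neg_sq_div_two_mul hk hC
  have hCi := integrable_exp_neg_sq_div_two.const_mul C
  have hsum := ((hasDerivAt_integral_Ioi_exp_neg_sq_div_two w).const_mul C).add hd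
  have hanti : Antitone (fun y : ℝ =>
      ∫ t in Set.Ioi y, (C * exp (-(t ^ 2) / 2) + exp (-(t ^ 2) / 2) * k t)) := by
    intro a b hab
    refine setIntegral_mono_set (hCi.add hki).integrableOn (ae_of_all _ fun t => ?_)
      (Set.Ioi_subset_Ioi hab).eventuallyLE
    simp only [Pi.zero_apply]
    nlinarith [exp_pos (-(t ^ 2) / 2), neg_le_of_abs_le (hC t)]
  have heq : (fun y : ℝ =>
      ∫ t in Set.Ioi y, (C * exp (-(t ^ 2) / 2) + exp (-(t ^ 2) / 2) * k t)) =
      (fun y : ℝ => C * ∫ t in Set.Ioi y, exp (-(t ^ 2) / 2)) +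
        fun y : ℝ => ∫ t in Set.Ioi y, exp (-(t ^ 2) / 2) * k t := by
    funext y
    rw [integral_add hCi.integrableOn hki.integrableOn, integral_const_mul]
    rfl
  have h := hanti.deriv_nonpos (x := w)
  rw [heq, hsum.deriv] at h
  linarith

lemma abs_integral_exp_neg_sq_div_two_mul_le {k : ℝ → ℝ} {C : ℝ} (hC : ∀ t, |k t| ≤ C)
    (s : Set ℝ) :
    |∫ t in s, exp (-(t ^ 2) / 2) * k t| ≤ C * ∫ t in s, exp (-(t ^ 2) / 2) := by
  rw [← integral_const_mul]
  refine norm_integral_le_of_norm_le (f := fun t => exp (-(t ^ 2) / 2) * k t)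
    (integrable_exp_neg_sq_div_two.const_mul C).integrableOn (ae_of_all _ fun t => ?_)
  rw [norm_eq_abs, abs_mul, abs_of_pos (exp_pos _), mul_comm]
  exact mul_le_mul_of_nonneg_right (hC t) (exp_pos _).le

lemma abs_integral_Ioi_exp_neg_sq_div_two_mul_le {k : ℝ → ℝ} {C : ℝ} (hk : Measurable k)
    (hC : ∀ t, |k t| ≤ C) (hzero : ∫ t, exp (-(t ^ 2) / 2) * k t = 0) (w : ℝ) :
    |∫ t in Set.Ioi w, exp (-(t ^ 2) / 2) * k t| ≤
      C * ∫ t in Set.Ioi |w|, exp (-(t ^ 2) / 2) := by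
  rcases le_total 0 w with hw | hw
  · rw [abs_of_nonneg hw]
    exact abs_integral_exp_neg_sq_div_two_mul_le hC _
  · have hki := integrable_exp_neg_sq_div_two_mul hk hC
    have hsplit := intervalIntegral.integral_Iic_add_Ioi (b := w) hki.integrableOn hki.integrableOn
    have hrefl := integral_comp_neg_Iic w (fun t : ℝ => exp (-(t ^ 2) / 2))
    simp only [neg_sq] at hrefl
    rw [hzero, add_comm] at hsplit
    rw [abs_of_nonpos hw, ← hrefl, eq_neg_of_add_eq_zero_left hsplit, abs_neg]
    exact abs_integral_exp_neg_sq_div_two_mul_le hC _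

lemma integral_exp_neg_sq_div_two_mul_sub_gaussianReal_integral {h : ℝ → ℝ}
    (hint : Integrable h (gaussianReal 0 1)) :
    ∫ t, exp (-(t ^ 2) / 2) * (h t - ∫ x, h x ∂(gaussianReal 0 1)) = 0 := by
  have hz : ∫ t, (h t - ∫ x, h x ∂(gaussianReal 0 1)) ∂(gaussianReal 0 1) = 0 := by
    rw [integral_sub hint (integrable_const _)]
    simp
  rw [integral_gaussianReal_eq_integral_smul one_ne_zero] at hz
  simp only [gaussianPDFReal, NNReal.coe_one, mul_one, sub_zero, smul_eq_mul, mul_assoc] at hz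
  rw [integral_const_mul] at hz
  exact (mul_eq_zero.mp hz).resolve_left (by positivity)

/-- Bounds for the solution of the Stein equation for bounded measurable `h`:
if `|h(w) - E h(Z)| ≤ C` for all `w`, then the solution
`f_h(w) = -e^{w²/2} ∫_w^∞ e^{-t²/2}(h t - E h(Z)) dt` satisfies
`|f_h(w)| ≤ √(π/2) C` for all `w`, and `|f_h'(w)| ≤ 2 C` at every point `w`
where `f_h` is differentiable. -/
theorem stein_equation_solution_bounds_bounded_h
    (h : ℝ → ℝ) (hmeas : Measurable h) (hbdd : ∃ B, ∀ x, |h x| ≤ B)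
    (m : ℝ) (hm : m = ∫ t, h t ∂(gaussianReal 0 1))
    (C : ℝ) (hC : ∀ w, |h w - m| ≤ C)
    (f : ℝ → ℝ)
    (hf : ∀ w, f w =
      -(Real.exp (w ^ 2 / 2)) * ∫ t in Set.Ioi w, Real.exp (-(t ^ 2) / 2) * (h t - m)) :
    (∀ w, |f w| ≤ Real.sqrt (Real.pi / 2) * C) ∧
      (∀ w, DifferentiableAt ℝ f w → |deriv f w| ≤ 2 * C) := by
  have hC0 : 0 ≤ C := (abs_nonneg _).trans (hC 0)
  have hk : Measurable fun t => h t - m := hmeas.sub_const m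
  have hzero : ∫ t, exp (-(t ^ 2) / 2) * (h t - m) = 0 := by
    obtain ⟨B, hB⟩ := hbdd
    rw [hm]
    exact integral_exp_neg_sq_div_two_mul_sub_gaussianReal_integral
      (Integrable.of_bound hmeas.aestronglyMeasurable B (ae_of_all _ hB))
  have hexp : ∀ w : ℝ, exp (w ^ 2 / 2) * exp (-(w ^ 2) / 2) = 1 := fun w => by
    rw [← exp_add, neg_div, add_neg_cancel, exp_zero]
  have hf_abs : ∀ w, |f w| ≤
      exp (w ^ 2 / 2) * (C * ∫ t in Set.Ioi |w|, exp (-(t ^ 2) / 2)) := fun w => by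
    rw [hf w, abs_mul, abs_neg, abs_of_pos (exp_pos _)]
    exact mul_le_mul_of_nonneg_left
      (abs_integral_Ioi_exp_neg_sq_div_two_mul_le hk hC hzero w) (exp_pos _).le
  refine ⟨fun w => (hf_abs w).trans ?_, fun w hw => ?_⟩
  · have h1 := integral_Ioi_exp_neg_sq_div_two_le (abs_nonneg w)
    rw [sq_abs] at h1
    calc exp (w ^ 2 / 2) * (C * ∫ t in Set.Ioi |w|, exp (-(t ^ 2) / 2))
        ≤ exp (w ^ 2 / 2) * (C * (exp (-(w ^ 2) / 2) * √(π / 2))) := by gcongr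
      _ = (exp (w ^ 2 / 2) * exp (-(w ^ 2) / 2)) * (√(π / 2) * C) := by ring
      _ = √(π / 2) * C := by rw [hexp, one_mul]
  · have hwf : |w * f w| ≤ C := by
      have h1 := mul_integral_Ioi_exp_neg_sq_div_two_le |w|
      rw [sq_abs] at h1
      rw [abs_mul]
      calc |w| * |f w|
          ≤ |w| * (exp (w ^ 2 / 2) * (C * ∫ t in Set.Ioi |w|, exp (-(t ^ 2) / 2))) :=
            mul_le_mul_of_nonneg_left (hf_abs w) (abs_nonneg w)
        _ = exp (w ^ 2 / 2) * C * (|w| * ∫ t in Set.Ioi |w|, exp (-(t ^ 2) / 2)) := by ring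
        _ ≤ exp (w ^ 2 / 2) * C * exp (-(w ^ 2) / 2) := by gcongr
        _ = C := by rw [mul_right_comm, hexp, one_mul]
    have hpos := exp_pos (-(w ^ 2) / 2)
    have hder : HasDerivAt (fun y => exp (-(y ^ 2) / 2) * f y)
        (exp (-(w ^ 2) / 2) * (deriv f w - w * f w)) w := by
      have h1 := ((((hasDerivAt_id w).pow 2).neg.div_const 2).exp).mul hw.hasDerivAt
      convert! h1 using 1
      simp
      ring
    have hupper := le_of_hasDerivAt_integral_Ioi_exp_neg_sq_div_two_mul
      (k := fun t => -(h t - m)) (C := C) hk.neg (fun t => by rw [abs_neg]; exact hC t)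
      (hder.congr_of_eventuallyEq (.of_forall fun y => by
        simp only [mul_neg, integral_neg]
        rw [hf y]
        linear_combination (∫ t in Set.Ioi y, exp (-(t ^ 2) / 2) * (h t - m)) * hexp y))
    have hlower := le_of_hasDerivAt_integral_Ioi_exp_neg_sq_div_two_mul hk hC
      (hder.neg.congr_of_eventuallyEq (.of_forall fun y => by
        simp only [Pi.neg_apply]
        rw [hf y]
        linear_combination -(∫ t in Set.Ioi y, exp (-(t ^ 2) / 2) * (h t - m)) * hexp y))
    have h1 : deriv f w - w * f w ≤ C := by nlinarith
    have h2 : -C ≤ deriv f w - w * f w := by nlinarith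
    rw [abs_le] at hwf ⊢
    constructor <;> linarith
end

section
/- Fix x ∈ ℝ and ε > 0, let h_{x,ε} be the piecewise linear function equal to 1 on (−∞,x], 0 on [x+ε,∞), and 1 + (x−w)/ε on (x, x+ε), and let f_{x,ε} be the bounded solution of the Stein equation for h_{x,ε}. Then for all w, t ∈ ℝ: |f_{x,ε}'(w+t) − f_{x,ε}'(w)| ≤ (|w| + 1)|t| + (1/ε)∫_{t∧0}^{t∨0} 1{x ≤ w + u ≤ x + ε} du ≤ (|w| + 1)|t| + 1{x − (0∨t) ≤ w ≤ x − (0∧t) + ε}. -/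
open MeasureTheory ProbabilityTheory Real

/-- The unnormalized standard Gaussian density. -/
noncomputable def gaussKernel (t : ℝ) : ℝ := Real.exp (-(t ^ 2) / 2)

/-- The unnormalized upper Gaussian tail. -/
noncomputable def gaussTail (w : ℝ) : ℝ := ∫ t in Set.Ioi w, gaussKernel t

lemma gaussKernel_pos (t : ℝ) : 0 < gaussKernel t := Real.exp_pos _

lemma gaussKernel_neg (t : ℝ) : gaussKernel (-t) = gaussKernel t := by
  simp [gaussKernel]

lemma continuous_gaussKernel : Continuous gaussKernel := by
  unfold gaussKernel; fun_prop

lemma gaussKernel_eq (t : ℝ) : gaussKernel t = Real.exp (-(1 / 2) * t ^ 2) := by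
  unfold gaussKernel; congr 1; ring

lemma integrable_gaussKernel : Integrable gaussKernel := by
  rw [funext gaussKernel_eq]
  exact integrable_exp_neg_mul_sq (by norm_num)

lemma integral_gaussKernel : ∫ t, gaussKernel t = √(2 * π) := by
  simp_rw [gaussKernel_eq]
  rw [integral_gaussian]
  congr 1; ring

lemma gaussTail_nonneg (w : ℝ) : 0 ≤ gaussTail w :=
  integral_nonneg fun t => (gaussKernel_pos t).le

lemma integral_Iic_gaussKernel (w : ℝ) : ∫ t in Set.Iic w, gaussKernel t = gaussTail (-w) := by
  rw [gaussTail, ← integral_comp_neg_Iic]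
  simp_rw [gaussKernel_neg]

lemma integral_Iic_add_Ioi {g : ℝ → ℝ} (hg : Integrable g) (w : ℝ) :
    (∫ t in Set.Iic w, g t) + ∫ t in Set.Ioi w, g t = ∫ t, g t := by
  rw [← Set.compl_Iic]
  exact integral_add_compl measurableSet_Iic hg

lemma gaussTail_neg_add (w : ℝ) : gaussTail (-w) + gaussTail w = √(2 * π) := by
  rw [← integral_Iic_gaussKernel, ← integral_gaussKernel]
  exact integral_Iic_add_Ioi integrable_gaussKernel w

/-- A one-parameter family of Mills ratio bounds. -/
lemma mul_gaussTail_le {w a : ℝ} (hwa : 0 < w + a) :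
    (w + a) * gaussTail w ≤ Real.exp (a ^ 2 / 2) * gaussKernel w := by
  have hint : IntegrableOn (fun t => Real.exp (a ^ 2 / 2) * gaussKernel w *
      (Real.exp ((w + a) * w) * Real.exp (-(w + a) * t))) (Set.Ioi w) :=
    ((integrableOn_exp_mul_Ioi (by linarith) w).const_mul _).const_mul _
  have hle : gaussTail w ≤ ∫ t in Set.Ioi w, Real.exp (a ^ 2 / 2) * gaussKernel w *
      (Real.exp ((w + a) * w) * Real.exp (-(w + a) * t)) := by
    refine integral_mono integrable_gaussKernel.integrableOn hint fun t => ?_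
    simp only [gaussKernel, ← Real.exp_add]
    apply Real.exp_le_exp.2
    nlinarith [sq_nonneg (t - w - a)]
  rw [integral_const_mul, integral_const_mul, integral_exp_mul_Ioi (by linarith)] at hle
  calc (w + a) * gaussTail w ≤ (w + a) * _ := mul_le_mul_of_nonneg_left hle hwa.le
    _ = Real.exp (a ^ 2 / 2) * gaussKernel w *
        (Real.exp ((w + a) * w) * Real.exp (-(w + a) * w)) := by
      have := hwa.ne'
      have h' : -(w + a) ≠ 0 := neg_ne_zero.2 this
      field_simp
    _ = _ := by
      rw [← Real.exp_add, neg_mul, add_neg_cancel, Real.exp_zero, mul_one]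

lemma self_mul_gaussTail_le (w : ℝ) : w * gaussTail w ≤ gaussKernel w := by
  rcases le_or_gt w 0 with hw | hw
  · exact (mul_nonpos_of_nonpos_of_nonneg hw (gaussTail_nonneg w)).trans (gaussKernel_pos w).le
  · simpa using mul_gaussTail_le (w := w) (a := 0) (by simpa using hw)

lemma gaussTail_le_gaussKernel {w : ℝ} (hw : 9 / 10 ≤ w) : gaussTail w ≤ gaussKernel w := by
  have h1 := mul_gaussTail_le (w := w) (a := 1 / 2) (by linarith)
  have h2 : Real.exp ((1 / 2 : ℝ) ^ 2 / 2) ≤ 7 / 5 := by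
    have h3 := Real.add_one_le_exp (-((1 / 2 : ℝ) ^ 2 / 2))
    rw [Real.exp_neg] at h3
    have h4 := Real.exp_pos ((1 / 2 : ℝ) ^ 2 / 2)
    have h5 := mul_le_mul_of_nonneg_right h3 h4.le
    rw [inv_mul_cancel₀ h4.ne'] at h5
    linarith
  nlinarith [gaussTail_nonneg w, gaussKernel_pos w]

lemma gaussTail_neg_mul_gaussTail_le (w : ℝ) :
    gaussTail (-w) * gaussTail w ≤ √(2 * π) * gaussKernel w := by
  wlog hw : 0 ≤ w generalizing w
  · have := this (-w) (by linarith)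
    rwa [neg_neg, gaussKernel_neg, mul_comm] at this
  have hsum := gaussTail_neg_add w
  have hP := gaussTail_nonneg (-w)
  have hQ := gaussTail_nonneg w
  rcases le_total w (9 / 10) with h | h
  · have hS : √(2 * π) ≤ 2.508 := by
      rw [Real.sqrt_le_left (by norm_num)]
      linarith [Real.pi_lt_d4]
    have hE : 0.63 ≤ gaussKernel w := by
      have h1 : Real.exp (-0.2025) ^ 2 ≤ gaussKernel w := by
        rw [← Real.exp_nat_mul]
        apply Real.exp_le_exp.2
        norm_num
        nlinarith
      have h2 := Real.add_one_le_exp (-0.2025)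
      nlinarith
    have hS0 : 0 ≤ √(2 * π) := Real.sqrt_nonneg _
    have h4 : gaussTail (-w) * gaussTail w ≤ √(2 * π) * √(2 * π) / 4 := by
      rw [← hsum]
      nlinarith [sq_nonneg (gaussTail (-w) - gaussTail w)]
    nlinarith
  · exact mul_le_mul (by linarith) (gaussTail_le_gaussKernel h) hQ (Real.sqrt_nonneg _)

section SteinSolution

variable {h f : ℝ → ℝ} {m : ℝ}

lemma integrable_gaussKernel_mul (hc : Continuous h) (h0 : ∀ w, 0 ≤ h w) (h1 : ∀ w, h w ≤ 1) :
    Integrable fun t => gaussKernel t * h t := by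
  refine integrable_gaussKernel.mono (continuous_gaussKernel.mul hc).aestronglyMeasurable
    (ae_of_all _ fun t => ?_)
  rw [norm_mul, Real.norm_of_nonneg (h0 t)]
  exact mul_le_of_le_one_right (norm_nonneg _) (h1 t)

lemma integral_gaussianReal_eq_gaussKernel :
    √(2 * π) * ∫ t, h t ∂(gaussianReal 0 1) = ∫ t, gaussKernel t * h t := by
  have hS : √(2 * π) ≠ 0 := by positivity
  rw [integral_gaussianReal_eq_integral_smul one_ne_zero, ← integral_const_mul]
  congr 1; ext t
  simp only [gaussianPDFReal, gaussKernel, smul_eq_mul, NNReal.coe_one, mul_one, sub_zero]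
  field_simp

/-- The Stein solution in terms of the two partial integrals of the test function. -/
lemma stein_solution_mul (hc : Continuous h) (h0 : ∀ w, 0 ≤ h w) (h1 : ∀ w, h w ≤ 1)
    (hm : m = ∫ t, h t ∂(gaussianReal 0 1))
    (hf : ∀ w, f w =
      -(Real.exp (w ^ 2 / 2)) * ∫ t in Set.Ioi w, Real.exp (-(t ^ 2) / 2) * (h t - m)) (w : ℝ) :
    √(2 * π) * (f w * gaussKernel w) =
      (∫ t in Set.Iic w, gaussKernel t * h t) * gaussTail w
        - gaussTail (-w) * ∫ t in Set.Ioi w, gaussKernel t * h t := by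
  have hi := integrable_gaussKernel_mul hc h0 h1
  have e1 : ∫ t in Set.Ioi w, Real.exp (-(t ^ 2) / 2) * (h t - m) =
      (∫ t in Set.Ioi w, gaussKernel t * h t) - gaussTail w * m := by
    rw [gaussTail, ← integral_mul_const, ← integral_sub hi.integrableOn
      (integrable_gaussKernel.integrableOn.mul_const m)]
    congr 1; ext t; simp only [gaussKernel]; ring
  have e2 : Real.exp (w ^ 2 / 2) * gaussKernel w = 1 := by
    rw [gaussKernel, ← Real.exp_add, neg_div, add_neg_cancel, Real.exp_zero]
  have e3 : √(2 * π) * m = (∫ t in Set.Iic w, gaussKernel t * h t) +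
      ∫ t in Set.Ioi w, gaussKernel t * h t := by
    rw [hm, integral_gaussianReal_eq_gaussKernel, integral_Iic_add_Ioi hi]
  have e4 := gaussTail_neg_add w
  rw [hf, e1]
  generalize (∫ t in Set.Ioi w, gaussKernel t * h t) = B at *
  generalize (∫ t in Set.Iic w, gaussKernel t * h t) = A at *
  linear_combination (-√(2 * π) * (B - gaussTail w * m)) * e2 + gaussTail w * e3 + B * e4

lemma setIntegral_gaussKernel_mul_mem (hc : Continuous h) (h0 : ∀ w, 0 ≤ h w) (h1 : ∀ w, h w ≤ 1)
    (s : Set ℝ) :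
    0 ≤ ∫ t in s, gaussKernel t * h t ∧
      ∫ t in s, gaussKernel t * h t ≤ ∫ t in s, gaussKernel t :=
  ⟨integral_nonneg fun t => mul_nonneg (gaussKernel_pos t).le (h0 t),
    integral_mono (integrable_gaussKernel_mul hc h0 h1).integrableOn
      integrable_gaussKernel.integrableOn
      fun t => mul_le_of_le_one_right (gaussKernel_pos t).le (h1 t)⟩

lemma abs_stein_solution_le_one (hc : Continuous h) (h0 : ∀ w, 0 ≤ h w) (h1 : ∀ w, h w ≤ 1)
    (hm : m = ∫ t, h t ∂(gaussianReal 0 1))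
    (hf : ∀ w, f w =
      -(Real.exp (w ^ 2 / 2)) * ∫ t in Set.Ioi w, Real.exp (-(t ^ 2) / 2) * (h t - m)) (w : ℝ) :
    |f w| ≤ 1 := by
  have e := stein_solution_mul hc h0 h1 hm hf w
  obtain ⟨hA0, hA1⟩ := setIntegral_gaussKernel_mul_mem hc h0 h1 (Set.Iic w)
  obtain ⟨hB0, hB1⟩ := setIntegral_gaussKernel_mul_mem hc h0 h1 (Set.Ioi w)
  rw [integral_Iic_gaussKernel] at hA1
  change _ ≤ gaussTail w at hB1
  have hP := gaussTail_nonneg (-w)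
  have hQ := gaussTail_nonneg w
  have hPQ := gaussTail_neg_mul_gaussTail_le w
  have hSE : 0 < √(2 * π) * gaussKernel w := mul_pos (by positivity) (gaussKernel_pos w)
  have hAQ := mul_le_mul_of_nonneg_right hA1 hQ
  have hPB := mul_le_mul_of_nonneg_left hB1 hP
  have hAQ0 := mul_nonneg hA0 hQ
  have hPB0 := mul_nonneg hP hB0
  have e' : f w * (√(2 * π) * gaussKernel w) = √(2 * π) * (f w * gaussKernel w) := by ring
  rw [abs_le]
  constructor
  · refine le_of_mul_le_mul_right ?_ hSE
    linarith
  · refine le_of_mul_le_mul_right ?_ hSE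
    linarith

lemma abs_stein_solution_deriv_le_one (hc : Continuous h) (h0 : ∀ w, 0 ≤ h w) (h1 : ∀ w, h w ≤ 1)
    (hm : m = ∫ t, h t ∂(gaussianReal 0 1))
    (hf : ∀ w, f w =
      -(Real.exp (w ^ 2 / 2)) * ∫ t in Set.Ioi w, Real.exp (-(t ^ 2) / 2) * (h t - m)) (w : ℝ) :
    |w * f w + (h w - m)| ≤ 1 := by
  have e := stein_solution_mul hc h0 h1 hm hf w
  have hi := integrable_gaussKernel_mul hc h0 h1
  obtain ⟨hA0, hA1⟩ := setIntegral_gaussKernel_mul_mem hc h0 h1 (Set.Iic w)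
  obtain ⟨hB0, hB1⟩ := setIntegral_gaussKernel_mul_mem hc h0 h1 (Set.Ioi w)
  have e3 : √(2 * π) * m = (∫ t in Set.Iic w, gaussKernel t * h t) +
      ∫ t in Set.Ioi w, gaussKernel t * h t := by
    rw [hm, integral_gaussianReal_eq_gaussKernel, integral_Iic_add_Ioi hi]
  rw [integral_Iic_gaussKernel] at hA1
  change _ ≤ gaussTail w at hB1
  have hsum := gaussTail_neg_add w
  have hQ := sub_nonneg.2 (self_mul_gaussTail_le w)
  have hP := self_mul_gaussTail_le (-w)
  rw [gaussKernel_neg, neg_mul, neg_le_iff_add_nonneg] at hP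
  have hSE : 0 < √(2 * π) * gaussKernel w := mul_pos (by positivity) (gaussKernel_pos w)
  have hh1 := mul_le_mul_of_nonneg_right (h1 w) hSE.le
  have hh0 := mul_nonneg (h0 w) hSE.le
  generalize (∫ t in Set.Ioi w, gaussKernel t * h t) = B at *
  generalize (∫ t in Set.Iic w, gaussKernel t * h t) = A at *
  have key : (w * f w + (h w - m)) * (√(2 * π) * gaussKernel w) =
      h w * (√(2 * π) * gaussKernel w) - A * (gaussKernel w - w * gaussTail w)
        - B * (gaussKernel w + w * gaussTail (-w)) := by
    linear_combination w * e - gaussKernel w * e3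
  have total : gaussTail (-w) * (gaussKernel w - w * gaussTail w)
      + gaussTail w * (gaussKernel w + w * gaussTail (-w)) = √(2 * π) * gaussKernel w := by
    linear_combination gaussKernel w * hsum
  have a1 := mul_nonneg hA0 hQ
  have a2 := mul_nonneg hB0 hP
  have b1 := mul_le_mul_of_nonneg_right hA1 hQ
  have b2 := mul_le_mul_of_nonneg_right hB1 hP
  rw [abs_le]
  constructor
  · refine le_of_mul_le_mul_right ?_ hSE
    linarith
  · refine le_of_mul_le_mul_right ?_ hSE
    linarith

lemma hasDerivAt_integral_Ioi {k : ℝ → ℝ} (hk : Continuous k) (hi : Integrable k) (w : ℝ) :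
    HasDerivAt (fun w => ∫ t in Set.Ioi w, k t) (-k w) w := by
  have e : (fun w => ∫ t in Set.Ioi w, k t) =
      fun w => (∫ t in Set.Ioi 0, k t) - ∫ t in (0 : ℝ)..w, k t := by
    ext w
    rw [← intervalIntegral.integral_Ioi_sub_Ioi' hi.integrableOn hi.integrableOn, sub_sub_cancel]
  rw [e]
  exact (intervalIntegral.integral_hasDerivAt_right (hk.intervalIntegrable _ _)
    (hk.stronglyMeasurableAtFilter _ _) hk.continuousAt).const_sub _

/-- The Stein solution solves the Stein equation. -/
lemma hasDerivAt_stein_solution (hc : Continuous h) (h0 : ∀ w, 0 ≤ h w) (h1 : ∀ w, h w ≤ 1)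
    (hf : ∀ w, f w =
      -(Real.exp (w ^ 2 / 2)) * ∫ t in Set.Ioi w, Real.exp (-(t ^ 2) / 2) * (h t - m)) (w : ℝ) :
    HasDerivAt f (w * f w + (h w - m)) w := by
  have hi : Integrable fun t => Real.exp (-(t ^ 2) / 2) * (h t - m) := by
    refine ((integrable_gaussKernel_mul hc h0 h1).sub
      (integrable_gaussKernel.mul_const m)).congr (ae_of_all _ fun t => ?_)
    simp only [gaussKernel, Pi.sub_apply]; ring
  have hk : Continuous fun t => Real.exp (-(t ^ 2) / 2) * (h t - m) := by fun_prop
  have hE : HasDerivAt (fun w : ℝ => -(Real.exp (w ^ 2 / 2))) (-(Real.exp (w ^ 2 / 2) * w)) w := by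
    refine (((hasDerivAt_pow 2 w).div_const 2).exp).neg.congr_deriv ?_
    norm_num
  rw [funext hf]
  refine (hE.mul (hasDerivAt_integral_Ioi hk hi w)).congr_deriv ?_
  have e2 : Real.exp (w ^ 2 / 2) * Real.exp (-(w ^ 2) / 2) = 1 := by
    rw [← Real.exp_add, neg_div, add_neg_cancel, Real.exp_zero]
  linear_combination (h w - m) * e2

/-- Increments of the derivative of the Stein solution, up to the increment of the test
function. -/
lemma abs_deriv_stein_solution_sub_le (hc : Continuous h) (h0 : ∀ w, 0 ≤ h w) (h1 : ∀ w, h w ≤ 1)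
    (hm : m = ∫ t, h t ∂(gaussianReal 0 1))
    (hf : ∀ w, f w =
      -(Real.exp (w ^ 2 / 2)) * ∫ t in Set.Ioi w, Real.exp (-(t ^ 2) / 2) * (h t - m)) (w t : ℝ) :
    |deriv f (w + t) - deriv f w| ≤ (|w| + 1) * |t| + |h (w + t) - h w| := by
  have hd := hasDerivAt_stein_solution hc h0 h1 hf
  have hlip : |f (w + t) - f w| ≤ |t| := by
    have := convex_univ.norm_image_sub_le_of_norm_hasDerivWithin_le (C := 1) (f := f)
      (fun y _ => (hd y).hasDerivWithinAt)
      (fun y _ => abs_stein_solution_deriv_le_one hc h0 h1 hm hf y)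
      (Set.mem_univ w) (Set.mem_univ (w + t))
    simpa using this
  rw [(hd _).deriv, (hd _).deriv]
  have e : (w + t) * f (w + t) + (h (w + t) - m) - (w * f w + (h w - m)) =
      w * (f (w + t) - f w) + t * f (w + t) + (h (w + t) - h w) := by ring
  rw [e]
  refine (abs_add_three _ _ _).trans ?_
  rw [abs_mul, abs_mul]
  have b1 := mul_le_mul_of_nonneg_left hlip (abs_nonneg w)
  have b2 := mul_le_mul_of_nonneg_left (abs_stein_solution_le_one hc h0 h1 hm hf (w + t))
    (abs_nonneg t)
  linarith

end SteinSolution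

lemma intervalIntegral_ite_Icc {a b c d : ℝ} (hab : a ≤ b) (w : ℝ) :
    ∫ u in a..b, (if c ≤ w + u ∧ w + u ≤ d then (1 : ℝ) else 0) =
      max 0 (min b (d - w) - max a (c - w)) := by
  have e : (fun u => if c ≤ w + u ∧ w + u ≤ d then (1 : ℝ) else 0) =
      (Set.Icc (c - w) (d - w)).indicator fun _ => 1 := by
    ext u
    simp only [Set.indicator_apply, Set.mem_Icc]
    congr 1
    rw [sub_le_iff_le_add', le_sub_iff_add_le']
  rw [intervalIntegral.integral_of_le hab, ← integral_Icc_eq_integral_Ioc, e,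
    setIntegral_indicator measurableSet_Icc, Set.Icc_inter_Icc, setIntegral_const]
  rw [Real.volume_real_Icc, smul_eq_mul, mul_one, max_comm]

lemma ramp_eq_max_min {x ε : ℝ} (hε : 0 < ε) (w : ℝ) :
    (if w ≤ x then 1 else if x + ε ≤ w then 0 else 1 + (x - w) / ε) =
      max 0 (min 1 (1 + (x - w) / ε)) := by
  split_ifs with h₁ h₂
  · have : 0 ≤ (x - w) / ε := div_nonneg (by linarith) hε.le
    rw [min_eq_left (by linarith), max_eq_right zero_le_one]
  · have : (x - w) / ε ≤ -1 := by rw [div_le_iff₀ hε]; linarith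
    rw [max_eq_left ((min_le_right _ _).trans (by linarith))]
  · have h3 : (x - w) / ε ≤ 0 := div_nonpos_of_nonpos_of_nonneg (by linarith) hε.le
    have h4 : -1 ≤ (x - w) / ε := by rw [le_div_iff₀ hε]; linarith
    rw [min_eq_right (by linarith), max_eq_right (by linarith)]

/-- Increments of the ramp are bounded by the overlap with its sloped part. -/
lemma abs_ramp_sub_le {x ε : ℝ} (hε : 0 < ε) {h : ℝ → ℝ}
    (hh : ∀ w, h w = if w ≤ x then 1 else if x + ε ≤ w then 0 else 1 + (x - w) / ε)
    {y z : ℝ} (hyz : y ≤ z) :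
    |h z - h y| ≤ 1 / ε * max 0 (min z (x + ε) - max y x) := by
  have hε' : ∀ w, h w * ε = if w ≤ x then ε else if x + ε ≤ w then 0 else ε + (x - w) := by
    intro w
    rw [hh]
    split_ifs
    · rw [one_mul]
    · rw [zero_mul]
    · field_simp
  have key : |h z * ε - h y * ε| ≤ max 0 (min z (x + ε) - max y x) := by
    rw [hε', hε', abs_le]
    constructor <;> grind
  rw [← sub_mul, abs_mul, abs_of_pos hε] at key
  rw [one_div, inv_mul_eq_div, le_div_iff₀ hε]
  exact key


/-- Second-order smoothness bound for the solution `f_{x,ε}` of the Stein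
equation for the piecewise linear test function `h_{x,ε}`: for all `w, t`,
`|f_{x,ε}'(w+t) - f_{x,ε}'(w)|
  ≤ (|w|+1)|t| + (1/ε) ∫_{t∧0}^{t∨0} 1{x ≤ w+u ≤ x+ε} du
  ≤ (|w|+1)|t| + 1{x - (0 ∨ t) ≤ w ≤ x - (0 ∧ t) + ε}`. -/
theorem stein_solution_smoothed_indicator_second_order
    (x ε : ℝ) (hε : 0 < ε)
    (h : ℝ → ℝ)
    (hh : ∀ w, h w =
      if w ≤ x then 1 else if x + ε ≤ w then 0 else 1 + (x - w) / ε)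
    (m : ℝ) (hm : m = ∫ t, h t ∂(gaussianReal 0 1))
    (f : ℝ → ℝ)
    (hf : ∀ w, f w =
      -(Real.exp (w ^ 2 / 2)) * ∫ t in Set.Ioi w, Real.exp (-(t ^ 2) / 2) * (h t - m)) :
    ∀ w t : ℝ,
      |deriv f (w + t) - deriv f w| ≤
          (|w| + 1) * |t| +
            (1 / ε) *
              ∫ u in (min t 0)..(max t 0),
                (if x ≤ w + u ∧ w + u ≤ x + ε then (1 : ℝ) else 0) ∧
        (|w| + 1) * |t| +
            (1 / ε) *
              (∫ u in (min t 0)..(max t 0),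
                (if x ≤ w + u ∧ w + u ≤ x + ε then (1 : ℝ) else 0)) ≤
          (|w| + 1) * |t| +
            (if x - max 0 t ≤ w ∧ w ≤ x - min 0 t + ε then (1 : ℝ) else 0) := by
  intro w t
  have hr : ∀ w, h w = max 0 (min 1 (1 + (x - w) / ε)) := fun w => by
    rw [hh, ramp_eq_max_min hε]
  have hc : Continuous h := by
    rw [funext hr]
    fun_prop
  have h0 : ∀ w, 0 ≤ h w := fun w => by rw [hr]; exact le_max_left _ _
  have h1 : ∀ w, h w ≤ 1 := fun w => by rw [hr]; exact max_le zero_le_one (min_le_left _ _)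
  have hmm : min t 0 ≤ max t 0 := min_le_max
  rw [intervalIntegral_ite_Icc hmm]
  constructor
  · refine (abs_deriv_stein_solution_sub_le hc h0 h1 hm hf w t).trans ?_
    gcongr
    rcases le_total t 0 with ht | ht
    · rw [min_eq_left ht, max_eq_right ht, abs_sub_comm]
      refine (abs_ramp_sub_le hε hh (by linarith : w + t ≤ w)).trans_eq ?_
      congr 2
      grind
    · rw [min_eq_right ht, max_eq_left ht]
      refine (abs_ramp_sub_le hε hh (by linarith : w ≤ w + t)).trans_eq ?_
      congr 2
      grind
  · gcongr
    rw [one_div, inv_mul_eq_div, div_le_iff₀ hε]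
    split_ifs with hw
    · grind
    · grind
end
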